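/- The even hyperbolic lattice U ⊕ E₈(2) ⊕ A₁ ⊕ A₁ (the 2-elementary lattice with invariants (r,a,δ) = (12,10,1)) is reflective: the subgroup W_r of O(S) generated by reflections in all roots has finite index in O(S). -/

import Mathlib

open Matrix

/-- The bilinear form on `ℤⁿ` associated to a Gram matrix `G`. -/
def bform {n : ℕ} (G : Matrix (Fin n) (Fin n) ℤ) (x y : Fin n → ℤ) : ℤ :=
  x ⬝ᵥ G.mulVec y

/-- The orthogonal group `O(S)` of the lattice with Gram matrix `G`:
all `ℤ`-module automorphisms preserving the bilinear form. -/
def OrthGroup (n : ℕ) (G : Matrix (Fin n) (Fin n) ℤ) :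
    Subgroup ((Fin n → ℤ) ≃ₗ[ℤ] (Fin n → ℤ)) where
  carrier := {f | ∀ x y, bform G (f x) (f y) = bform G x y}
  one_mem' := fun _ _ => rfl
  mul_mem' := by
    intro f g hf hg x y
    exact (hf (g x) (g y)).trans (hg x y)
  inv_mem' := by
    intro f hf x y
    have h := (hf (f⁻¹ x) (f⁻¹ y)).symm
    rwa [show f (f⁻¹ x) = x from f.apply_symm_apply x,
      show f (f⁻¹ y) = y from f.apply_symm_apply y] at h

/-- A root: a vector of square `-2`, or of square `-4` whose pairing with
the whole lattice is even. -/
def IsRoot {n : ℕ} (G : Matrix (Fin n) (Fin n) ℤ) (α : Fin n → ℤ) : Prop :=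
  bform G α α = -2 ∨ (bform G α α = -4 ∧ ∀ x : Fin n → ℤ, (2 : ℤ) ∣ bform G α x)

/-- `f` is the reflection in a root `α`. -/
def IsReflection {n : ℕ} (G : Matrix (Fin n) (Fin n) ℤ)
    (f : (Fin n → ℤ) ≃ₗ[ℤ] (Fin n → ℤ)) : Prop :=
  ∃ α : Fin n → ℤ, IsRoot G α ∧
    ∀ x : Fin n → ℤ, f x = x - ((2 * bform G x α) / bform G α α) • α

/-- The subgroup `W_r` of `O(S)` generated by the reflections in all roots. -/
def Wr (n : ℕ) (G : Matrix (Fin n) (Fin n) ℤ) : Subgroup ↥(OrthGroup n G) :=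
  Subgroup.closure {f | IsReflection G f.val}

open Matrix

/-- Orthogonal direct sum of two Gram matrices. -/
def dsum {m k : ℕ} (A : Matrix (Fin m) (Fin m) ℤ) (B : Matrix (Fin k) (Fin k) ℤ) :
    Matrix (Fin (m + k)) (Fin (m + k)) ℤ :=
  Matrix.reindex finSumFinEquiv finSumFinEquiv (Matrix.fromBlocks A 0 0 B)

/-- Gram matrix of the hyperbolic plane `U`. -/
def gramU : Matrix (Fin 2) (Fin 2) ℤ := !![0, 1; 1, 0]

/-- Gram matrix of `A₁ = ⟨-2⟩`. -/
def gramA1 : Matrix (Fin 1) (Fin 1) ℤ := !![-2]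

/-- Gram matrix (= negative Cartan matrix) of a simply laced root lattice with
given Dynkin diagram edges. -/
def adjGram (n : ℕ) (E : List (ℕ × ℕ)) : Matrix (Fin n) (Fin n) ℤ :=
  Matrix.of fun i j =>
    if i = j then -2 else if (i.1, j.1) ∈ E ∨ (j.1, i.1) ∈ E then 1 else 0

/-- Gram matrix of the negative definite root lattice `Dₙ`
(in the root basis `e₁+e₂, e₂-e₁, e₃-e₂, …, eₙ-eₙ₋₁` of `{x ∈ ℤⁿ : Σxᵢ even}`
with the negative of the standard Euclidean form). -/
def gramD (n : ℕ) : Matrix (Fin n) (Fin n) ℤ :=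
  adjGram n ((0, 2) :: (List.range (n - 2)).map fun k => (k + 1, k + 2))

/-- Gram matrix (negative Cartan matrix) of `E₈`. -/
def gramE8 : Matrix (Fin 8) (Fin 8) ℤ :=
  adjGram 8 [(0, 2), (1, 3), (2, 3), (3, 4), (4, 5), (5, 6), (6, 7)]

/-- Gram matrix (negative Cartan matrix) of `E₇`. -/
def gramE7 : Matrix (Fin 7) (Fin 7) ℤ :=
  adjGram 7 [(0, 2), (1, 3), (2, 3), (3, 4), (4, 5), (5, 6)]

/-- The Gram matrix of the even 2-elementary hyperbolic lattice `U ⊕ E₈(2) ⊕ A₁ ⊕ A₁`,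
with invariants `(r,a,δ) = (12,10,1)`. -/
def gramS :=
  dsum gramU (dsum ((2 : ℤ) • gramE8) (dsum gramA1 gramA1))

section BilinearForm

variable {n : ℕ} {G : Matrix (Fin n) (Fin n) ℤ}

theorem bform_add_left (x y z : Fin n → ℤ) :
    bform G (x + y) z = bform G x z + bform G y z := by
  simp [bform, add_dotProduct]

theorem bform_smul_left (c : ℤ) (x y : Fin n → ℤ) :
    bform G (c • x) y = c * bform G x y := by
  rw [bform, bform, smul_dotProduct, smul_eq_mul]

theorem bform_add_right (x y z : Fin n → ℤ) :
    bform G x (y + z) = bform G x y + bform G x z := by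
  simp [bform, mulVec_add]

theorem bform_smul_right (c : ℤ) (x y : Fin n → ℤ) :
    bform G x (c • y) = c * bform G x y := by
  rw [bform, bform, mulVec_smul, dotProduct_smul, smul_eq_mul]

theorem bform_comm (hG : G.IsSymm) (x y : Fin n → ℤ) : bform G x y = bform G y x := by
  rw [bform, bform, dotProduct_mulVec, ← mulVec_transpose, hG.eq, dotProduct_comm]

/-- A linear combination `p • x + q • y` has the expected square. -/
theorem bform_self_combination (hG : G.IsSymm) (p q : ℤ) (x y : Fin n → ℤ) :
    bform G (p • x + q • y) (p • x + q • y) =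
      p ^ 2 * bform G x x + 2 * (p * q) * bform G x y + q ^ 2 * bform G y y := by
  simp only [bform_add_left, bform_add_right, bform_smul_left, bform_smul_right,
    bform_comm hG y x]
  ring

/-- In a hyperbolic lattice the orthogonal complement of every vector of positive square is
negative semidefinite, as soon as this holds for one such vector. -/
theorem bform_self_nonpos_of_orthogonal (hG : G.IsSymm) {u ρ : Fin n → ℤ}
    (hneg : ∀ w, bform G w u = 0 → bform G w w ≤ 0) (hρ : 0 < bform G ρ ρ) {v : Fin n → ℤ}
    (hv : bform G v ρ = 0) : bform G v v ≤ 0 := by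
  by_contra! h
  have hρu : bform G ρ u ≠ 0 := fun h0 => (hneg ρ h0).not_gt hρ
  have hw := hneg (bform G ρ u • v + (-bform G v u) • ρ) (by
    rw [bform_add_left, bform_smul_left, bform_smul_left]; ring)
  rw [bform_self_combination hG, hv] at hw
  have : 0 < bform G ρ u ^ 2 * bform G v v := by positivity
  nlinarith [mul_nonneg (sq_nonneg (bform G v u)) hρ.le]

/-- Vectors of positive square with positive product lie in the same half of the light cone. -/
theorem bform_pos_of_same_cone (hG : G.IsSymm) {x z ρ : Fin n → ℤ}
    (hneg : ∀ w, bform G w ρ = 0 → bform G w w ≤ 0) (hx : 0 < bform G x x)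
    (hz : 0 < bform G z z) (hxz : 0 < bform G x z) (hxρ : 0 < bform G x ρ) :
    0 < bform G z ρ := by
  by_contra! h
  have hw := hneg ((-bform G z ρ) • x + bform G x ρ • z) (by
    rw [bform_add_left, bform_smul_left, bform_smul_left]; ring)
  rw [bform_self_combination hG] at hw
  have h1 : 0 < bform G x ρ ^ 2 * bform G z z := by positivity
  have h2 : 0 ≤ (-bform G z ρ) * bform G x ρ * bform G x z :=
    mul_nonneg (mul_nonneg (by linarith) hxρ.le) hxz.le
  nlinarith [mul_nonneg (sq_nonneg (bform G z ρ)) hx.le]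

end BilinearForm

section Reflections

variable {n : ℕ} {G : Matrix (Fin n) (Fin n) ℤ}

/-- A vector `α` whose pairing with the lattice is `m` times that of a coroot `d`. -/
theorem bform_root {α d : Fin n → ℤ} {m : ℤ} (hd : G *ᵥ α = m • d) (x : Fin n → ℤ) :
    bform G x α = m * (x ⬝ᵥ d) := by
  rw [bform, hd, dotProduct_smul, smul_eq_mul]

/-- The reflection in a root `α` with coroot `d` is `x ↦ x + (x ⬝ᵥ d) • α`. -/
theorem exists_reflection_mem_Wr (hG : G.IsSymm) {α d : Fin n → ℤ} {m : ℤ}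
    (hm : m = 1 ∨ m = 2) (hd : G *ᵥ α = m • d) (hα : α ⬝ᵥ d = -2) :
    ∃ s ∈ Wr n G, ∀ x, s.1 x = x + (x ⬝ᵥ d) • α := by
  have hαα : bform G α α = -2 * m := by rw [bform_root hd, hα]; ring
  let L : (Fin n → ℤ) →ₗ[ℤ] (Fin n → ℤ) :=
    { toFun := fun x => x + (x ⬝ᵥ d) • α
      map_add' := fun x y => by simp only [add_dotProduct, add_smul]; abel
      map_smul' := fun c x => by
        rw [smul_dotProduct, smul_eq_mul, mul_smul, smul_add, RingHom.id_apply] }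
  have hL : Function.Involutive L := fun x => by
    change x + (x ⬝ᵥ d) • α + ((x + (x ⬝ᵥ d) • α) ⬝ᵥ d) • α = x
    rw [add_dotProduct, smul_dotProduct, hα, smul_eq_mul]
    module
  have hmem : LinearEquiv.ofInvolutive L hL ∈ OrthGroup n G := fun x y => by
    change bform G (x + (x ⬝ᵥ d) • α) (y + (y ⬝ᵥ d) • α) = bform G x y
    simp only [bform_add_left, bform_add_right, bform_smul_left, bform_smul_right,
      bform_comm hG α y, bform_root hd, add_dotProduct, smul_dotProduct, hα, smul_eq_mul]
    ring
  refine ⟨⟨_, hmem⟩, Subgroup.subset_closure ⟨α, ?_, fun x => ?_⟩, fun x => rfl⟩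
  · rcases hm with rfl | rfl
    · exact Or.inl (by rw [hαα]; norm_num)
    · refine Or.inr ⟨by rw [hαα]; norm_num, fun x => ?_⟩
      rw [bform_comm hG, bform_root hd]
      exact dvd_mul_right _ _
  · change x + (x ⬝ᵥ d) • α = _
    have hm0 : -2 * m ≠ 0 := by rcases hm with rfl | rfl <;> norm_num
    have : 2 * bform G x α / bform G α α = -(x ⬝ᵥ d) := by
      rw [hαα, bform_root hd]
      exact Int.ediv_eq_of_eq_mul_right hm0 (by ring)
    rw [this, neg_smul, sub_neg_eq_add]

variable {ι : Type*} {α d : ι → Fin n → ℤ} {m : ι → ℤ} {u ρ : Fin n → ℤ}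

/-- Every vector of positive square in the half cone of `ρ` can be moved by `W_r` into the
chamber cut out by finitely many roots, all of them positive on `ρ`. -/
theorem exists_mem_Wr_chamber (hG : G.IsSymm) (hm : ∀ i, m i = 1 ∨ m i = 2)
    (hd : ∀ i, G *ᵥ α i = m i • d i) (hα : ∀ i, α i ⬝ᵥ d i = -2)
    (hneg : ∀ w, bform G w ρ = 0 → bform G w w ≤ 0) (hρα : ∀ i, 0 < bform G (α i) ρ)
    (x : Fin n → ℤ) (hx : 0 < bform G x x) (hxρ : 0 < bform G x ρ) :
    ∃ w ∈ Wr n G, ∀ i, 0 ≤ w.1 x ⬝ᵥ d i := by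
  induction hk : (bform G x ρ).toNat using Nat.strong_induction_on generalizing x with
  | _ k ih =>
    by_cases hC : ∀ i, 0 ≤ x ⬝ᵥ d i
    · exact ⟨1, one_mem _, hC⟩
    push Not at hC
    obtain ⟨i, hi⟩ := hC
    obtain ⟨s, hs, hsx⟩ := exists_reflection_mem_Wr hG (hm i) (hd i) (hα i)
    have hmi : 0 < m i := by rcases hm i with h | h <;> rw [h] <;> norm_num
    have hss : bform G (s.1 x) (s.1 x) = bform G x x := s.2 x x
    have hxs : 0 < bform G x (s.1 x) := by
      rw [hsx, bform_add_right, bform_smul_right, bform_root (hd i)]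
      nlinarith [mul_nonneg hmi.le (sq_nonneg (x ⬝ᵥ d i))]
    have hsρ := bform_pos_of_same_cone hG hneg hx (hss ▸ hx) hxs hxρ
    have hlt : bform G (s.1 x) ρ < bform G x ρ := by
      rw [hsx, bform_add_left, bform_smul_left]
      nlinarith [hρα i]
    obtain ⟨w, hw, hwC⟩ := ih _ (by omega) (s.1 x) (hss ▸ hx) hsρ rfl
    exact ⟨w * s, mul_mem hw hs, hwC⟩

/-- If only finitely many vectors in the orbit of `u` lie in the chamber, and the stabilizer
of `u` is finite, then `W_r` has finite index. -/
theorem finiteIndex_Wr_of_finite_chamber (hG : G.IsSymm) (hm : ∀ i, m i = 1 ∨ m i = 2)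
    (hd : ∀ i, G *ᵥ α i = m i • d i) (hα : ∀ i, α i ⬝ᵥ d i = -2)
    (hu : 0 < bform G u u) (hneg : ∀ w, bform G w u = 0 → bform G w w ≤ 0)
    (hfin : ∀ a c, {z | bform G z u = a ∧ bform G z z = c}.Finite)
    (hρ : 0 < bform G ρ ρ) (hρα : ∀ i, 0 < bform G (α i) ρ)
    (hchamber : {x | bform G x x = bform G u u ∧ ∀ i, 0 ≤ x ⬝ᵥ d i}.Finite) :
    (Wr n G).FiniteIndex := by
  set C := {x | bform G x x = bform G u u ∧ ∀ i, 0 ≤ x ⬝ᵥ d i}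
  have hnegρ : ∀ w, bform G w ρ = 0 → bform G w w ≤ 0 := fun w hw =>
    bform_self_nonpos_of_orthogonal hG hneg hρ hw
  have hstab : {g : OrthGroup n G | g.1 u = u}.Finite := by
    refine Set.Finite.of_finite_image (f := fun g i => g.1 (Pi.single i 1)) ?_ ?_
    · refine (Set.Finite.pi (t := fun i : Fin n => {z | bform G z u = bform G (Pi.single i 1) u ∧
        bform G z z = bform G (Pi.single i 1) (Pi.single i 1)}) fun i => hfin _ _).subset ?_
      rintro _ ⟨g, hg, rfl⟩ i -
      refine ⟨?_, g.2 _ _⟩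
      have := g.2 (Pi.single i 1) u
      rwa [show g.1 u = u from hg] at this
    · intro g _ h _ hgh
      refine Subtype.ext (LinearEquiv.toLinearMap_injective (LinearMap.pi_ext' fun i => ?_))
      exact LinearMap.ext_ring (congrFun hgh i)
  let K : Set (OrthGroup n G) := (fun g => g.1 u) ⁻¹' (C ∪ (fun x => -x) '' C)
  have hK : K.Finite := by
    refine (hchamber.union (hchamber.image _)).preimage' fun v _ => ?_
    rcases Set.eq_empty_or_nonempty ((fun g : OrthGroup n G => g.1 u) ⁻¹' {v}) with h | ⟨g₀, h₀⟩
    · rw [h]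
      exact Set.finite_empty
    · refine (hstab.image (g₀ * ·)).subset fun g hg => ⟨g₀⁻¹ * g, ?_, by simp⟩
      change g₀.1.symm (g.1 u) = u
      rw [show g.1 u = v from hg, ← show g₀.1 u = v from h₀]
      exact g₀.1.symm_apply_apply u
  have hcover : ∀ g : OrthGroup n G, ∃ w ∈ Wr n G, w * g ∈ K := fun g => by
    have hgu : bform G (g.1 u) (g.1 u) = bform G u u := g.2 u u
    have hne : bform G (g.1 u) ρ ≠ 0 := fun h => (hnegρ _ h).not_gt (hgu ▸ hu)
    rcases hne.lt_or_gt with h | h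
    · have hgn : bform G (-g.1 u) (-g.1 u) = bform G u u := by simpa [bform, mulVec_neg] using hgu
      obtain ⟨w, hw, hwC⟩ := exists_mem_Wr_chamber hG hm hd hα hnegρ hρα (-g.1 u) (hgn ▸ hu)
        (by simpa [bform] using h)
      refine ⟨w, hw, Or.inr ⟨w.1 (-g.1 u), ⟨(w.2 _ _).trans hgn, hwC⟩, ?_⟩⟩
      change -w.1 (-g.1 u) = w.1 (g.1 u)
      rw [map_neg, neg_neg]
    · obtain ⟨w, hw, hwC⟩ := exists_mem_Wr_chamber hG hm hd hα hnegρ hρα (g.1 u) (hgu ▸ hu) h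
      exact ⟨w, hw, Or.inl ⟨(w.2 _ _).trans hgu, hwC⟩⟩
  have := hK.to_subtype
  have : Finite (OrthGroup n G ⧸ Wr n G) := by
    refine Finite.of_surjective (fun k : K => (QuotientGroup.mk k.1⁻¹ : _ ⧸ Wr n G)) fun q => ?_
    obtain ⟨g, rfl⟩ := QuotientGroup.mk_surjective q
    obtain ⟨w, hw, hwK⟩ := hcover g⁻¹
    refine ⟨⟨_, hwK⟩, QuotientGroup.eq.2 ?_⟩
    simpa using hw
  exact Subgroup.finiteIndex_of_finite_quotient

end Reflections

section Nonnegative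

variable {n : ℕ} {C : Matrix (Fin n) (Fin n) ℤ} {y : Fin n → ℤ}

theorem bform_eq_sum (x y : Fin n → ℤ) : bform C x y = ∑ i, ∑ j, x i * (C i j * y j) := by
  simp only [bform, dotProduct, mulVec, Finset.mul_sum]

/-- If the coefficients of a form are nonnegative, it dominates each of its monomials on
nonnegative vectors. -/
theorem mul_le_bform_self (hC : ∀ i j, 0 ≤ C i j) (hy : ∀ i, 0 ≤ y i) {i j : Fin n}
    (hij : 0 < C i j) : y i * y j ≤ bform C y y := by
  have hpos : ∀ i j, 0 ≤ y i * (C i j * y j) := fun i j =>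
    mul_nonneg (hy i) (mul_nonneg (hC i j) (hy j))
  calc y i * y j ≤ y i * (C i j * y j) :=
        mul_le_mul_of_nonneg_left (le_mul_of_one_le_left (hy j) hij) (hy i)
    _ ≤ ∑ j, y i * (C i j * y j) :=
        Finset.single_le_sum (f := fun j => y i * (C i j * y j)) (fun j _ => hpos i j)
          (Finset.mem_univ j)
    _ ≤ bform C y y := by
        rw [bform_eq_sum]
        exact Finset.single_le_sum (f := fun i => ∑ j, y i * (C i j * y j))
          (fun i _ => Finset.sum_nonneg fun j _ => hpos i j) (Finset.mem_univ i)

/-- A form vanishes at vectors supported on a set of indices without mutual coefficients. -/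
theorem bform_eq_zero_of_isolated {S : Set (Fin n)} (hS : ∀ j, j ∉ S → y j = 0)
    (hCS : ∀ j ∈ S, ∀ k ∈ S, C j k = 0) : bform C y y = 0 := by
  rw [bform_eq_sum]
  refine Finset.sum_eq_zero fun j _ => Finset.sum_eq_zero fun k _ => ?_
  by_cases hj : j ∈ S
  · by_cases hk : k ∈ S
    · rw [hCS j hj k hk, zero_mul, mul_zero]
    · rw [hS k hk, mul_zero, mul_zero]
  · rw [hS j hj, zero_mul]

end Nonnegative

section TwelveTenOne

/-- The simple roots of a fundamental chamber for `W_r`: an affine diagram of type `E₈`, an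
affine diagram of type `C₂`, and two further roots. -/
def simpleRoot : Fin 14 → Fin 12 → ℤ :=
  ![![0, 0, -1, 0, 0, 0, 0, 0, 0, 0, 0, 0],
    ![0, 0, 0, -1, 0, 0, 0, 0, 0, 0, 0, 0],
    ![0, 0, 0, 0, -1, 0, 0, 0, 0, 0, 0, 0],
    ![0, 0, 0, 0, 0, -1, 0, 0, 0, 0, 0, 0],
    ![0, 0, 0, 0, 0, 0, -1, 0, 0, 0, 0, 0],
    ![0, 0, 0, 0, 0, 0, 0, -1, 0, 0, 0, 0],
    ![0, 0, 0, 0, 0, 0, 0, 0, -1, 0, 0, 0],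
    ![0, 0, 0, 0, 0, 0, 0, 0, 0, -1, 0, 0],
    ![2, 0, 2, 3, 4, 6, 5, 4, 3, 2, 0, 0],
    ![0, 0, 0, 0, 0, 0, 0, 0, 0, 0, -1, 1],
    ![0, 0, 0, 0, 0, 0, 0, 0, 0, 0, 0, -1],
    ![1, 0, 0, 0, 0, 0, 0, 0, 0, 0, 1, 0],
    ![-1, 1, 0, 0, 0, 0, 0, 0, 0, 0, 0, 0],
    ![2, 2, 4, 5, 7, 10, 8, 6, 4, 2, 1, 1]]

/-- The coroots of `simpleRoot`. -/
def simpleCoroot : Fin 14 → Fin 12 → ℤ :=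
  ![![0, 0, 2, 0, -1, 0, 0, 0, 0, 0, 0, 0],
    ![0, 0, 0, 2, 0, -1, 0, 0, 0, 0, 0, 0],
    ![0, 0, -1, 0, 2, -1, 0, 0, 0, 0, 0, 0],
    ![0, 0, 0, -1, -1, 2, -1, 0, 0, 0, 0, 0],
    ![0, 0, 0, 0, 0, -1, 2, -1, 0, 0, 0, 0],
    ![0, 0, 0, 0, 0, 0, -1, 2, -1, 0, 0, 0],
    ![0, 0, 0, 0, 0, 0, 0, -1, 2, -1, 0, 0],
    ![0, 0, 0, 0, 0, 0, 0, 0, -1, 2, 0, 0],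
    ![0, 1, 0, 0, 0, 0, 0, 0, 0, -1, 0, 0],
    ![0, 0, 0, 0, 0, 0, 0, 0, 0, 0, 1, -1],
    ![0, 0, 0, 0, 0, 0, 0, 0, 0, 0, 0, 2],
    ![0, 1, 0, 0, 0, 0, 0, 0, 0, 0, -2, 0],
    ![1, -1, 0, 0, 0, 0, 0, 0, 0, 0, 0, 0],
    ![1, 1, -1, 0, 0, 0, 0, 0, 0, 0, -1, -1]]

/-- Minus half the squares of the simple roots. -/
def simpleScale : Fin 14 → ℤ := ![2, 2, 2, 2, 2, 2, 2, 2, 2, 2, 1, 1, 1, 2]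

/-- Nonnegative coefficients expressing the quadratic form through the pairings with the simple
roots. -/
def chamberCoeff : Fin 14 → Fin 14 → ℤ :=
  ![![0, 14, 8, 16, 20, 12, 8, 8, 8, 6, 6, 0, 2, 6],
    ![14, 0, 15, 12, 14, 12, 10, 10, 10, 0, 5, 0, 2, 10],
    ![8, 15, 4, 16, 23, 20, 19, 22, 25, 2, 4, 3, 10, 6],
    ![16, 12, 16, 8, 18, 20, 22, 28, 34, 2, 6, 6, 14, 10],
    ![20, 14, 23, 18, 4, 8, 10, 14, 18, 2, 8, 4, 6, 14],
    ![12, 12, 20, 20, 8, 0, 8, 16, 24, 0, 2, 8, 12, 4],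
    ![8, 10, 19, 22, 10, 8, 0, 10, 20, 0, 0, 10, 12, 0],
    ![8, 10, 22, 28, 14, 16, 10, 0, 10, 0, 0, 10, 8, 0],
    ![8, 10, 25, 34, 18, 24, 20, 10, 0, 0, 0, 10, 4, 0],
    ![6, 0, 2, 2, 2, 0, 0, 0, 0, 0, 5, 0, 2, 10],
    ![6, 5, 4, 6, 8, 2, 0, 0, 0, 5, 0, 0, 1, 5],
    ![0, 0, 3, 6, 4, 8, 10, 10, 10, 0, 0, 0, 6, 0],
    ![2, 2, 10, 14, 6, 12, 12, 8, 4, 2, 1, 6, 0, 0],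
    ![6, 10, 6, 10, 14, 4, 0, 0, 0, 10, 5, 0, 0, 0]]

theorem gramS_eq : (gramS : Matrix (Fin 12) (Fin 12) ℤ) =
    !![0, 1, 0, 0, 0, 0, 0, 0, 0, 0, 0, 0;
       1, 0, 0, 0, 0, 0, 0, 0, 0, 0, 0, 0;
       0, 0, -4, 0, 2, 0, 0, 0, 0, 0, 0, 0;
       0, 0, 0, -4, 0, 2, 0, 0, 0, 0, 0, 0;
       0, 0, 2, 0, -4, 2, 0, 0, 0, 0, 0, 0;
       0, 0, 0, 2, 2, -4, 2, 0, 0, 0, 0, 0;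
       0, 0, 0, 0, 0, 2, -4, 2, 0, 0, 0, 0;
       0, 0, 0, 0, 0, 0, 2, -4, 2, 0, 0, 0;
       0, 0, 0, 0, 0, 0, 0, 2, -4, 2, 0, 0;
       0, 0, 0, 0, 0, 0, 0, 0, 2, -4, 0, 0;
       0, 0, 0, 0, 0, 0, 0, 0, 0, 0, -2, 0;
       0, 0, 0, 0, 0, 0, 0, 0, 0, 0, 0, -2] := by
  decide +kernel

theorem bform_gramS_self (x : Fin 12 → ℤ) : bform gramS x x =
    2 * (x 0 * x 1) - 4 * (x 2 ^ 2 + x 3 ^ 2 + x 4 ^ 2 + x 5 ^ 2 + x 6 ^ 2 + x 7 ^ 2 + x 8 ^ 2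
      + x 9 ^ 2 - x 2 * x 4 - x 3 * x 5 - x 4 * x 5 - x 5 * x 6 - x 6 * x 7 - x 7 * x 8
      - x 8 * x 9) - 2 * (x 10 ^ 2 + x 11 ^ 2) := by
  rw [gramS_eq]
  simp [bform, dotProduct, mulVec, Fin.sum_univ_succ]
  ring

/-- A vector of square `2` in the chamber. -/
def normTwoVec : Fin 12 → ℤ := ![1, 1, 0, 0, 0, 0, 0, 0, 0, 0, 0, 0]

theorem bform_gramS_normTwoVec (x : Fin 12 → ℤ) :
    bform gramS x normTwoVec = x 0 + x 1 := by
  rw [gramS_eq]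
  simp [bform, dotProduct, mulVec, Fin.sum_univ_succ, normTwoVec]

theorem E8_form_bound (a b c d e f g h : ℤ) :
    a ^ 2 + b ^ 2 + c ^ 2 + d ^ 2 + e ^ 2 + f ^ 2 + g ^ 2 + h ^ 2 ≤
      400 * (a ^ 2 + b ^ 2 + c ^ 2 + d ^ 2 + e ^ 2 + f ^ 2 + g ^ 2 + h ^ 2
        - a * c - b * d - c * d - d * e - e * f - f * g - g * h) := by
  linarith [sq_nonneg (399 * a - 200 * c), sq_nonneg (119201 * c - 79800 * d),
    sq_nonneg (399 * b - 200 * d), sq_nonneg (399 * h - 200 * g),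
    sq_nonneg (119201 * g - 79800 * f), sq_nonneg (31601199 * f - 23840200 * e),
    sq_nonneg (7840838401 * e - 6320239800 * d), sq_nonneg d]

theorem sum_sq_le_bform_gramS (x : Fin 12 → ℤ) :
    ∑ i, x i ^ 2 ≤ 100 * (bform gramS x normTwoVec ^ 2 - bform gramS x x) := by
  rw [bform_gramS_normTwoVec, bform_gramS_self]
  simp only [Fin.sum_univ_succ, Fin.sum_univ_zero]
  simp only [Fin.succ_zero_eq_one, Fin.reduceSucc]
  nlinarith [E8_form_bound (x 2) (x 3) (x 4) (x 5) (x 6) (x 7) (x 8) (x 9), sq_nonneg (x 0),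
    sq_nonneg (x 1), sq_nonneg (x 10), sq_nonneg (x 11)]

theorem finite_setOf_abs_le {n : ℕ} (B : ℤ) : {x : Fin n → ℤ | ∀ i, |x i| ≤ B}.Finite :=
  (Set.finite_Icc (fun _ => -B) (fun _ => B)).subset fun _ hx =>
    ⟨fun i => (abs_le.1 (hx i)).1, fun i => (abs_le.1 (hx i)).2⟩

theorem ten_smul_gramS :
    (10 : ℤ) • (gramS : Matrix (Fin 12) (Fin 12) ℤ) =
      (of simpleCoroot)ᵀ * of chamberCoeff * of simpleCoroot := by
  decide +kernel

/-- The square of a vector is a nonnegative combination of products of its pairings with the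
simple roots: hence the chamber lies in the closed light cone. -/
theorem ten_mul_bform_gramS_self (x : Fin 12 → ℤ) :
    10 * bform gramS x x =
      bform (of chamberCoeff) (of simpleCoroot *ᵥ x) (of simpleCoroot *ᵥ x) := by
  have : 10 * bform gramS x x = x ⬝ᵥ ((10 : ℤ) • (gramS : Matrix (Fin 12) (Fin 12) ℤ)) *ᵥ x := by
    rw [smul_mulVec, dotProduct_smul, smul_eq_mul]
    rfl
  rw [this, ten_smul_gramS, bform, ← mulVec_mulVec, ← mulVec_mulVec, dotProduct_mulVec,
    vecMul_transpose]

theorem mulVec_simpleCoroot_relations (x : Fin 12 → ℤ) {y : Fin 14 → ℤ}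
    (hy : of simpleCoroot *ᵥ x = y) :
    y 11 = 2 * y 0 + 3 * y 1 + 4 * y 2 + 6 * y 3 + 5 * y 4 + 4 * y 5 + 3 * y 6 + 2 * y 7 + y 8
      - 2 * y 9 - y 10 ∧
    y 13 = y 1 + y 2 + 2 * y 3 + 2 * y 4 + 2 * y 5 + 2 * y 6 + 2 * y 7 + 2 * y 8 - y 9 - y 10
      + y 12 := by
  subst hy
  constructor <;>
  · simp [mulVec, dotProduct, simpleCoroot, Fin.sum_univ_succ]
    ring

theorem injective_mulVec_simpleCoroot : Function.Injective (of simpleCoroot *ᵥ ·) := by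
  intro x z h
  have h' : ∀ i, simpleCoroot i ⬝ᵥ x = simpleCoroot i ⬝ᵥ z := congrFun h
  simp [Fin.forall_fin_succ, dotProduct, simpleCoroot, Fin.sum_univ_succ] at h'
  funext i
  fin_cases i <;> simp <;> omega

/-- The vectors of square `2` in the chamber have bounded pairings with the simple roots. -/
theorem chamber_pairings_le {x : Fin 12 → ℤ} (hx : bform gramS x x = 2) {y : Fin 14 → ℤ}
    (hy : of simpleCoroot *ᵥ x = y) (h0 : ∀ i, 0 ≤ y i) (i : Fin 14) : y i ≤ 1000 := by
  have hc : bform (of chamberCoeff) y y = 20 := by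
    rw [← hy, ← ten_mul_bform_gramS_self, hx]
    rfl
  have hC : ∀ i j, 0 ≤ chamberCoeff i j := by decide +kernel
  have isolated (S : Set (Fin 14)) :=
    bform_eq_zero_of_isolated (C := of chamberCoeff) (y := y) (S := S)
  have bound : ∀ i j, chamberCoeff i j ≠ 0 → 20 < y i → y j = 0 := fun i j hij hi => by
    have := mul_le_bform_self (C := of chamberCoeff) hC h0 ((hC i j).lt_of_ne' hij)
    have := h0 j
    by_contra hj
    have : 1 ≤ y j := by omega
    nlinarith
  have cusp : ∀ i, (∀ j k, chamberCoeff i j = 0 → chamberCoeff i k = 0 →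
      chamberCoeff j k = 0) → y i ≤ 20 := fun i hi => by
    by_contra! h
    have := isolated {j | chamberCoeff i j = 0} (fun j hj => bound i j hj h)
      (fun j hj k hk => hi j k hj hk)
    omega
  obtain ⟨r1, r2⟩ := mulVec_simpleCoroot_relations x hy
  have b0 : y 0 ≤ 20 := cusp 0 (by decide +kernel)
  have b1 : y 1 ≤ 20 := cusp 1 (by decide +kernel)
  have b2 : y 2 ≤ 20 := cusp 2 (by decide +kernel)
  have b3 : y 3 ≤ 20 := cusp 3 (by decide +kernel)
  have b4 : y 4 ≤ 20 := cusp 4 (by decide +kernel)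
  have b5 : y 5 ≤ 20 := cusp 5 (by decide +kernel)
  have b12 : y 12 ≤ 20 := cusp 12 (by decide +kernel)
  have h6 := h0 6
  have h7 := h0 7
  have h8 := h0 8
  have h9 := h0 9
  have h10 := h0 10
  have h11 := h0 11
  have h13 := h0 13
  have b9 : y 9 ≤ 100 := by
    by_contra! h
    have z := fun j hj => bound 9 j hj (by omega)
    have := z 0 (by decide +kernel)
    have := z 2 (by decide +kernel)
    have := z 3 (by decide +kernel)
    have := z 4 (by decide +kernel)
    have := z 10 (by decide +kernel)
    have := z 12 (by decide +kernel)
    have := z 13 (by decide +kernel)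
    omega
  have b11 : y 11 ≤ 100 := by
    by_contra! h
    have z := fun j hj => bound 11 j hj (by omega)
    have := z 2 (by decide +kernel)
    have := z 3 (by decide +kernel)
    have := z 4 (by decide +kernel)
    have := z 5 (by decide +kernel)
    have := z 6 (by decide +kernel)
    have := z 7 (by decide +kernel)
    have := z 8 (by decide +kernel)
    omega
  have common : ∀ i, (i = 6 ∨ i = 7 ∨ i = 8) → 20 < y i → y 0 = 0 ∧ y 1 = 0 ∧ y 2 = 0 ∧ y 3 = 0 ∧
      y 4 = 0 ∧ y 5 = 0 ∧ y 11 = 0 ∧ y 12 = 0 := fun i hi h => by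
    have z := fun j hj => bound i j hj h
    refine ⟨z 0 ?_, z 1 ?_, z 2 ?_, z 3 ?_, z 4 ?_, z 5 ?_, z 11 ?_, z 12 ?_⟩ <;>
    rcases hi with rfl | rfl | rfl <;> decide +kernel
  have b6 : y 6 ≤ 100 := by
    by_contra! h
    have := common 6 (by simp) (by omega)
    have := bound 6 7 (by decide +kernel) (by omega)
    have := bound 6 8 (by decide +kernel) (by omega)
    omega
  have b8 : y 8 ≤ 100 := by
    by_contra! h
    have := common 8 (by simp) (by omega)
    have := bound 8 6 (by decide +kernel) (by omega)
    have := bound 8 7 (by decide +kernel) (by omega)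
    have := bound 13 9 (by decide +kernel) (by omega)
    have := bound 13 10 (by decide +kernel) (by omega)
    omega
  have b7 : y 7 ≤ 200 := by
    by_contra! h
    obtain ⟨z0, z1, z2, z3, z4, z5, z11, z12⟩ := common 7 (by simp) (by omega)
    have z6 := bound 7 6 (by decide +kernel) (by omega)
    have z8 := bound 7 8 (by decide +kernel) (by omega)
    have z9 := bound 10 9 (by decide +kernel) (by omega)
    have z13 : y 13 = 0 := by omega
    have := isolated {7, 10} (by
      intro j hj
      fin_cases j <;> first | assumption | simp at hj) (by
      rintro j (rfl | rfl) k (rfl | rfl) <;> decide +kernel)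
    omega
  have b10 : y 10 ≤ 1000 := by
    by_contra! h
    have z := fun j hj => bound 10 j hj (by omega)
    have := z 0 (by decide +kernel)
    have := z 1 (by decide +kernel)
    have := z 2 (by decide +kernel)
    have := z 3 (by decide +kernel)
    have := z 4 (by decide +kernel)
    have := z 5 (by decide +kernel)
    have := z 9 (by decide +kernel)
    have := z 12 (by decide +kernel)
    have := z 13 (by decide +kernel)
    omega
  have b13 : y 13 ≤ 1000 := by
    by_contra! h
    have z := fun j hj => bound 13 j hj (by omega)
    have := z 9 (by decide +kernel)
    have := z 10 (by decide +kernel)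
    omega
  fin_cases i <;> (simp; omega)

end TwelveTenOne

/-- The lattice `U ⊕ E₈(2) ⊕ A₁ ⊕ A₁` is reflective: the subgroup `W_r` of `O(S)`
generated by the reflections in all roots has finite index in `O(S)`. -/
theorem reflective_12_10_1 : (Wr _ gramS).FiniteIndex := by
  have hu : bform gramS normTwoVec normTwoVec = 2 := by decide +kernel
  have hfin : ∀ a c : ℤ,
      {z | bform gramS z normTwoVec = a ∧ bform gramS z z = c}.Finite := fun a c => by
    refine (finite_setOf_abs_le (100 * (a ^ 2 - c))).subset ?_
    rintro z ⟨rfl, rfl⟩ i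
    refine le_trans ?_ (sum_sq_le_bform_gramS z)
    refine le_trans ?_ (Finset.single_le_sum (f := fun i => z i ^ 2)
      (fun i _ => sq_nonneg (z i)) (Finset.mem_univ i))
    rw [← sq_abs]
    exact Int.le_self_sq _
  refine finiteIndex_Wr_of_finite_chamber (G := gramS) (u := normTwoVec) (α := simpleRoot)
    (d := simpleCoroot) (m := simpleScale)
    (ρ := ![31, 30, 46, 68, 91, 135, 110, 84, 57, 29, 2, 1]) (by decide +kernel)
    (by decide +kernel) (by decide +kernel) (by decide +kernel) (by rw [hu]; norm_num)
    (fun w hw => ?_) hfin (by decide +kernel) (by decide +kernel) ?_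
  · have := sum_sq_le_bform_gramS w
    have : 0 ≤ ∑ i, w i ^ 2 := Finset.sum_nonneg fun i _ => sq_nonneg (w i)
    rw [hw] at *
    linarith
  · refine ((finite_setOf_abs_le 1000).preimage
      injective_mulVec_simpleCoroot.injOn).subset fun x hx i => ?_
    have h0 : ∀ i, 0 ≤ (of simpleCoroot *ᵥ x) i := fun i => by
      have := hx.2 i
      rwa [dotProduct_comm] at this
    change |(of simpleCoroot *ᵥ x) i| ≤ 1000
    rw [abs_of_nonneg (h0 i)]
    exact chamber_pairings_le (hx.1.trans hu) rfl h0 i
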